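/- Fix n ≥ 2 and k ∈ (0,1). Define ψ* : (0,∞)ⁿ → (0,∞) by ψ*(y) = ((n+2)/(n+1)) · (1 − b_*(y)^{−(n+1)})/(1 − b_*(y)^{−(n+2)}) · y_(n)/(1+k), where b_*(y) = (y_(1)/(1−k))/(y_(n)/(1+k)) (the estimator θ̂_OPT). Then ψ* is scale equivariant, i.e. ψ*(cy) = c·ψ*(y) for all c > 0, and ψ* uniformly minimizes the squared-error risk in the class of scale-equivariant estimators: for every measurable ψ : (0,∞)ⁿ → (0,∞) with ψ(cy) = c·ψ(y) for all c > 0 and all y, and for every θ > 0, E[(θ − ψ*(Y))²] ≤ E[(θ − ψ(Y))²], where Y = (Y_1,…,Y_n) with Y_i i.i.d. uniform on [θ(1−k), θ(1+k)]. -/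

import Mathlib

open MeasureTheory

/-- The uniform probability distribution on the interval `[a, b]`. -/
noncomputable def unifIcc (a b : ℝ) : Measure ℝ :=
  (ENNReal.ofReal (b - a))⁻¹ • volume.restrict (Set.Icc a b)

/-- The estimator `θ̂_OPT`:
`ψ*(y) = ((n+2)/(n+1)) (1 - b_*(y)^(-(n+1)))/(1 - b_*(y)^(-(n+2))) y_(n)/(1+k)` with
`b_*(y) = (y_(1)/(1-k))/(y_(n)/(1+k))`. -/
noncomputable def psiOpt (n : ℕ) (k : ℝ) (y : Fin n → ℝ) : ℝ :=
  (((n : ℝ) + 2) / ((n : ℝ) + 1))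
    * (1 - (((⨅ i, y i) / (1 - k)) / ((⨆ i, y i) / (1 + k))) ^ (-((n : ℤ) + 1)))
    / (1 - (((⨅ i, y i) / (1 - k)) / ((⨆ i, y i) / (1 + k))) ^ (-((n : ℤ) + 2)))
    * ((⨆ i, y i) / (1 + k))

lemma psiOpt_smul (n : ℕ) (k : ℝ) {c : ℝ} (hc : 0 < c) (y : Fin n → ℝ) :
    psiOpt n k (c • y) = c * psiOpt n k y := by
  have h1 : (⨅ i, (c • y) i) = c * ⨅ i, y i := by
    simp [Real.mul_iInf_of_nonneg hc.le]
  have h2 : (⨆ i, (c • y) i) = c * ⨆ i, y i := by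
    simp [Real.mul_iSup_of_nonneg hc.le]
  unfold psiOpt
  rw [h1, h2, mul_div_assoc c (⨅ i, y i), mul_div_assoc c (⨆ i, y i),
    mul_div_mul_left _ _ hc.ne']
  ring

lemma measurable_psiOpt (n : ℕ) (k : ℝ) : Measurable (psiOpt n k) := by
  have h1 : Measurable fun y : Fin n → ℝ => ⨅ i, y i := .iInf measurable_pi_apply
  have h2 : Measurable fun y : Fin n → ℝ => ⨆ i, y i := .iSup measurable_pi_apply
  have hz (m : ℤ) : Measurable fun y : Fin n → ℝ =>
      (((⨅ i, y i) / (1 - k)) / ((⨆ i, y i) / (1 + k))) ^ m :=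
    ((h1.div_const _).div (h2.div_const _)).pow_const m
  exact (((measurable_const.sub (hz _)).const_mul _).div (measurable_const.sub (hz _))).mul
    (h2.div_const _)

lemma pi_unifIcc (n : ℕ) (a b : ℝ) (hab : a < b) :
    (Measure.pi fun _ : Fin n => unifIcc a b) =
      ((ENNReal.ofReal (b - a))⁻¹ ^ n) •
        (volume : Measure (Fin n → ℝ)).restrict (Set.univ.pi fun _ => Set.Icc a b) := by
  have hne : (ENNReal.ofReal (b - a))⁻¹ ≠ ⊤ := by simpa using hab
  have : IsFiniteMeasure (unifIcc a b) := by
    unfold unifIcc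
    exact Measure.smul_finite _ hne
  refine Measure.pi_eq fun s _ => ?_
  rw [volume_pi, Measure.restrict_pi_pi, Measure.smul_apply, Measure.pi_pi]
  simp [unifIcc, Finset.prod_mul_distrib]

lemma lintegral_eq_ofReal_pow_mul_lintegral_smul {n : ℕ} {s : ℝ} (hs : 0 < s)
    {F : (Fin n → ℝ) → ENNReal} (hF : Measurable F) :
    ∫⁻ y, F y = ENNReal.ofReal (s ^ n) * ∫⁻ y, F (s • y) := by
  have h : ∫⁻ y, F (s • y) = ENNReal.ofReal (s ^ n)⁻¹ * ∫⁻ y, F y := by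
    rw [← lintegral_map hF (measurable_const_smul s), Measure.map_addHaar_smul _ hs.ne',
      lintegral_smul_measure, smul_eq_mul, Module.finrank_fin_fun, abs_of_pos (by positivity)]
  rw [h, ← mul_assoc, ← ENNReal.ofReal_mul (by positivity), mul_inv_cancel₀ (by positivity),
    ENNReal.ofReal_one, one_mul]

/-- Integration along the rays of the half-space `0 < y i`, where rays are sampled with the
density `(y i)⁻¹` on `1 < y i`. -/
lemma lintegral_eq_lintegral_rays {n : ℕ} (i : Fin n) {F : (Fin n → ℝ) → ENNReal}
    (hF : Measurable F) (hpos : ∀ y, F y ≠ 0 → 0 < y i) :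
    ∫⁻ y, F y = ∫⁻ y, {y : Fin n → ℝ | 1 < y i}.indicator (fun y => ENNReal.ofReal (y i)⁻¹) y *
      ∫⁻ s in Set.Ioi (0 : ℝ), ENNReal.ofReal (s ^ (n - 1)) * F (s • y) := by
  have hn : n ≠ 0 := by rintro rfl; exact i.elim0
  let G : (Fin n → ℝ) → ℝ → ENNReal := fun y s =>
    {p : (Fin n → ℝ) × ℝ | p.2 < p.1 i}.indicator
      (fun p => ENNReal.ofReal (p.1 i)⁻¹ * F p.1) (y, s)
  have hi : Measurable fun y : Fin n → ℝ => y i := measurable_pi_apply i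
  have hG : Measurable (Function.uncurry G) := by
    refine Measurable.indicator ?_ (measurableSet_lt measurable_snd (hi.comp measurable_fst))
    exact ((hi.comp measurable_fst).inv.ennreal_ofReal).mul (hF.comp measurable_fst)
  have h1 (y : Fin n → ℝ) : F y = ∫⁻ s in Set.Ioi (0 : ℝ), G y s := by
    have : (fun s => G y s) =
        (Set.Iio (y i)).indicator fun _ => ENNReal.ofReal (y i)⁻¹ * F y := by
      ext s; simp [G, Set.indicator_apply]
    rw [this, lintegral_indicator measurableSet_Iio, Measure.restrict_restrict measurableSet_Iio,
      Set.inter_comm, Set.Ioi_inter_Iio, setLIntegral_const, Real.volume_Ioo, sub_zero]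
    by_cases h0 : F y = 0
    · simp [h0]
    · have hy := hpos y h0
      rw [mul_right_comm, ← ENNReal.ofReal_mul (by positivity), inv_mul_cancel₀ hy.ne',
        ENNReal.ofReal_one, one_mul]
  have h2 : ∀ s ∈ Set.Ioi (0 : ℝ), ∫⁻ y, G y s =
      ∫⁻ y, {y : Fin n → ℝ | 1 < y i}.indicator (fun y => ENNReal.ofReal (y i)⁻¹) y *
        (ENNReal.ofReal (s ^ (n - 1)) * F (s • y)) := by
    intro s (hs : 0 < s)
    have hGs : Measurable fun y => G y s := hG.comp (measurable_id.prodMk measurable_const)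
    rw [lintegral_eq_ofReal_pow_mul_lintegral_smul hs hGs,
      ← lintegral_const_mul' _ _ ENNReal.ofReal_ne_top]
    congr 1 with y
    have hlt : s < s * y i ↔ 1 < y i := by
      constructor <;> intro h <;> nlinarith
    by_cases hy : 1 < y i
    · have hp : s ^ n = s ^ (n - 1) * s := by rw [← pow_succ, Nat.sub_add_cancel (by omega)]
      have e : ENNReal.ofReal (s ^ n) * ENNReal.ofReal (s * y i)⁻¹ =
          ENNReal.ofReal (y i)⁻¹ * ENNReal.ofReal (s ^ (n - 1)) := by
        rw [← ENNReal.ofReal_mul (by positivity), ← ENNReal.ofReal_mul (by positivity), hp]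
        congr 1
        field_simp
      simp only [G, Set.indicator_apply, Set.mem_ofPred_eq, Pi.smul_apply, smul_eq_mul, hlt, hy,
        if_true]
      rw [← mul_assoc, e, mul_assoc]
    · simp [G, Set.indicator_apply, hlt, hy]
  have hW : Measurable
      ({y : Fin n → ℝ | 1 < y i}.indicator (fun y => ENNReal.ofReal (y i)⁻¹)) :=
    hi.inv.ennreal_ofReal.indicator (measurableSet_lt measurable_const hi)
  have hK : Measurable fun p : ℝ × (Fin n → ℝ) =>
      ENNReal.ofReal (p.1 ^ (n - 1)) * F (p.1 • p.2) :=
    (measurable_fst.pow_const _).ennreal_ofReal.mul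
      (hF.comp (measurable_fst.smul measurable_snd))
  calc ∫⁻ y, F y = ∫⁻ y, ∫⁻ s in Set.Ioi (0 : ℝ), G y s := by simp_rw [← h1]
    _ = ∫⁻ s in Set.Ioi (0 : ℝ), ∫⁻ y, G y s := lintegral_lintegral_swap hG.aemeasurable
    _ = ∫⁻ s in Set.Ioi (0 : ℝ), ∫⁻ y,
          {y : Fin n → ℝ | 1 < y i}.indicator (fun y => ENNReal.ofReal (y i)⁻¹) y *
            (ENNReal.ofReal (s ^ (n - 1)) * F (s • y)) :=
        setLIntegral_congr_fun measurableSet_Ioi h2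
    _ = ∫⁻ y, ∫⁻ s in Set.Ioi (0 : ℝ),
          {y : Fin n → ℝ | 1 < y i}.indicator (fun y => ENNReal.ofReal (y i)⁻¹) y *
            (ENNReal.ofReal (s ^ (n - 1)) * F (s • y)) :=
        lintegral_lintegral_swap ((hW.comp measurable_snd).mul hK).aemeasurable
    _ = _ := by
        congr 1 with y
        exact lintegral_const_mul _ (hK.comp (measurable_id.prodMk measurable_const))

lemma integral_pow_mul_sq (m : ℕ) (l h θ c : ℝ) :
    ∫ s in l..h, s ^ m * (θ - s * c) ^ 2 =
      θ ^ 2 * ((h ^ (m + 1) - l ^ (m + 1)) / (m + 1))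
        - 2 * θ * c * ((h ^ (m + 2) - l ^ (m + 2)) / (m + 2))
        + c ^ 2 * ((h ^ (m + 3) - l ^ (m + 3)) / (m + 3)) := by
  have e (s : ℝ) : s ^ m * (θ - s * c) ^ 2 =
      θ ^ 2 * s ^ m - 2 * θ * c * s ^ (m + 1) + c ^ 2 * s ^ (m + 2) := by ring
  have hint (d : ℝ) (j : ℕ) : IntervalIntegrable (fun s : ℝ => d * s ^ j) volume l h :=
    (by fun_prop : Continuous fun s : ℝ => d * s ^ j).intervalIntegrable l h
  simp_rw [e]
  rw [intervalIntegral.integral_add ((hint _ _).sub (hint _ _)) (hint _ _),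
    intervalIntegral.integral_sub (hint _ _) (hint _ _)]
  simp only [intervalIntegral.integral_const_mul, integral_pow]
  push_cast
  ring

lemma integral_pow_mul_sq_le {m : ℕ} {l h θ c₀ : ℝ} (hl : 0 < l) (hlh : l < h)
    (hc₀ : c₀ * ((h ^ (m + 3) - l ^ (m + 3)) / (m + 3)) =
      θ * ((h ^ (m + 2) - l ^ (m + 2)) / (m + 2))) (c : ℝ) :
    ∫ s in l..h, s ^ m * (θ - s * c₀) ^ 2 ≤ ∫ s in l..h, s ^ m * (θ - s * c) ^ 2 := by
  rw [integral_pow_mul_sq, integral_pow_mul_sq]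
  have hD : 0 ≤ (h ^ (m + 3) - l ^ (m + 3)) / ((m : ℝ) + 3) :=
    div_nonneg (sub_nonneg.2 (pow_le_pow_left₀ hl.le hlh.le _)) (by positivity)
  generalize (h ^ (m + 3) - l ^ (m + 3)) / ((m : ℝ) + 3) = D at *
  generalize (h ^ (m + 2) - l ^ (m + 2)) / ((m : ℝ) + 2) = B at *
  linear_combination mul_nonneg (sq_nonneg (c - c₀)) hD - 2 * (c - c₀) * hc₀

lemma setLIntegral_Icc_pow_mul_sq {m : ℕ} {l h : ℝ} (hl : 0 < l) (hlh : l ≤ h) (θ c : ℝ) :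
    ∫⁻ s in Set.Icc l h, ENNReal.ofReal (s ^ m * (θ - s * c) ^ 2) =
      ENNReal.ofReal (∫ s in l..h, s ^ m * (θ - s * c) ^ 2) := by
  rw [intervalIntegral.integral_of_le hlh, ← integral_Icc_eq_integral_Ioc,
    ofReal_integral_eq_lintegral_ofReal]
  · exact (by fun_prop : Continuous fun s : ℝ => s ^ m * (θ - s * c) ^ 2).continuousOn
      |>.integrableOn_compact isCompact_Icc
  · refine (ae_restrict_iff' measurableSet_Icc).2 (.of_forall fun s hs => ?_)
    have : 0 < s := hl.trans_le hs.1
    positivity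

lemma psiOpt_normal_equation {n : ℕ} (hn : n ≠ 0) {k θ : ℝ} (hk : k ∈ Set.Ioo (0 : ℝ) 1)
    (hθ : 0 < θ) {y : Fin n → ℝ} (hmin : 0 < ⨅ i, y i) (hmax : 0 < ⨆ i, y i)
    (hlt : θ * (1 - k) / (⨅ i, y i) < θ * (1 + k) / (⨆ i, y i)) :
    psiOpt n k y * (((θ * (1 + k) / (⨆ i, y i)) ^ (n - 1 + 3)
        - (θ * (1 - k) / (⨅ i, y i)) ^ (n - 1 + 3)) / ((n - 1 : ℕ) + 3)) =
      θ * (((θ * (1 + k) / (⨆ i, y i)) ^ (n - 1 + 2)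
        - (θ * (1 - k) / (⨅ i, y i)) ^ (n - 1 + 2)) / ((n - 1 : ℕ) + 2)) := by
  obtain ⟨hk0, hk1⟩ := hk
  have h1k : 0 < 1 - k := by linarith
  have h2k : 0 < 1 + k := by linarith
  unfold psiOpt
  generalize (⨅ i, y i) = u at *
  generalize (⨆ i, y i) = v at *
  obtain ⟨m, rfl⟩ : ∃ m, n = m + 1 := ⟨n - 1, by omega⟩
  set l := θ * (1 - k) / u with hldef
  set h := θ * (1 + k) / v with hhdef
  have hl : 0 < l := by positivity
  have hh : 0 < h := by positivity
  have hb : (u / (1 - k)) / (v / (1 + k)) = h / l := by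
    rw [hldef, hhdef]; field_simp
  have hv : v / (1 + k) = θ / h := by rw [hhdef]; field_simp
  have hz (j : ℕ) : (h / l) ^ (-(j : ℤ)) = l ^ j / h ^ j := by
    rw [zpow_neg, zpow_natCast, div_pow, inv_div]
  have e1 : -(((m + 1 : ℕ) : ℤ) + 1) = -((m + 2 : ℕ) : ℤ) := by push_cast; ring
  have e2 : -(((m + 1 : ℕ) : ℤ) + 2) = -((m + 3 : ℕ) : ℤ) := by push_cast; ring
  rw [hb, hv, e1, e2, hz, hz]
  have hD : h ^ (m + 3) - l ^ (m + 3) ≠ 0 :=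
    (sub_pos.2 (pow_lt_pow_left₀ hlt hl.le (by omega))).ne'
  have d1 : 1 - l ^ (m + 2) / h ^ (m + 2) = (h ^ (m + 2) - l ^ (m + 2)) / h ^ (m + 2) := by
    field_simp
  have d2 : 1 - l ^ (m + 3) / h ^ (m + 3) = (h ^ (m + 3) - l ^ (m + 3)) / h ^ (m + 3) := by
    field_simp
  rw [d1, d2]
  simp only [Nat.add_sub_cancel]
  generalize h ^ (m + 3) - l ^ (m + 3) = D at *
  generalize h ^ (m + 2) - l ^ (m + 2) = B at *
  have hm2 : (m : ℝ) + 2 ≠ 0 := by positivity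
  have hm3 : (m : ℝ) + 3 ≠ 0 := by positivity
  push_cast
  have f1 : (m : ℝ) + 1 + 2 = m + 3 := by ring
  have f2 : (m : ℝ) + 1 + 1 = m + 2 := by ring
  rw [f1, f2]
  field_simp
  ring

lemma smul_mem_pi_Icc_iff {n : ℕ} [NeZero n] {a b s : ℝ} (hs : 0 < s) {y : Fin n → ℝ}
    (hy : ∀ i, 0 < y i) :
    s • y ∈ Set.univ.pi (fun _ : Fin n => Set.Icc a b) ↔
      s ∈ Set.Icc (a / ⨅ i, y i) (b / ⨆ i, y i) := by
  obtain ⟨i₀, hi₀⟩ := exists_eq_ciInf_of_finite (f := y)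
  obtain ⟨i₁, hi₁⟩ := exists_eq_ciSup_of_finite (f := y)
  simp only [Set.mem_pi, Set.mem_univ, true_imp_iff, Set.mem_Icc, Pi.smul_apply, smul_eq_mul]
  rw [← hi₀, ← hi₁, div_le_iff₀ (hy i₀), le_div_iff₀ (hy i₁)]
  refine ⟨fun H => ⟨(H i₀).1, (H i₁).2⟩, fun H i => ⟨H.1.trans ?_, le_trans ?_ H.2⟩⟩
  · exact mul_le_mul_of_nonneg_left (hi₀ ▸ ciInf_le (Set.finite_range y).bddBelow i) hs.le
  · exact mul_le_mul_of_nonneg_left (hi₁ ▸ le_ciSup (Set.finite_range y).bddAbove i) hs.le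

/-- The squared-error loss along the ray through `y`, restricted to the sample space. -/
lemma lintegral_ray_loss {n : ℕ} [NeZero n] {a b θ : ℝ} (ha : 0 < a) {y : Fin n → ℝ}
    (hy : ∀ i, 0 < y i) {ψ : (Fin n → ℝ) → ℝ} (hψ : ∀ c : ℝ, 0 < c → ψ (c • y) = c * ψ y) :
    ∫⁻ s in Set.Ioi (0 : ℝ), ENNReal.ofReal (s ^ (n - 1)) *
      (Set.univ.pi fun _ : Fin n => Set.Icc a b).indicator
        (fun y => ENNReal.ofReal ((θ - ψ y) ^ 2)) (s • y) =
    ∫⁻ s in Set.Icc (a / ⨅ i, y i) (b / ⨆ i, y i),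
      ENNReal.ofReal (s ^ (n - 1) * (θ - s * ψ y) ^ 2) := by
  have hmin : 0 < ⨅ i, y i := by
    obtain ⟨i₀, hi₀⟩ := exists_eq_ciInf_of_finite (f := y)
    exact hi₀ ▸ hy i₀
  have hsub : Set.Icc (a / ⨅ i, y i) (b / ⨆ i, y i) ⊆ Set.Ioi (0 : ℝ) := fun s hs =>
    (div_pos ha hmin).trans_le hs.1
  rw [← Set.inter_eq_left.2 hsub, ← Measure.restrict_restrict measurableSet_Icc,
    ← lintegral_indicator measurableSet_Icc]
  refine setLIntegral_congr_fun measurableSet_Ioi fun s (hs : 0 < s) => ?_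
  by_cases hmem : s ∈ Set.Icc (a / ⨅ i, y i) (b / ⨆ i, y i)
  · rw [Set.indicator_of_mem hmem,
      Set.indicator_of_mem ((smul_mem_pi_Icc_iff hs hy).2 hmem), hψ s hs,
      ENNReal.ofReal_mul (by positivity)]
  · rw [Set.indicator_of_notMem hmem,
      Set.indicator_of_notMem (mt (smul_mem_pi_Icc_iff hs hy).1 hmem), mul_zero]

lemma lintegral_ray_loss_psiOpt_le {n : ℕ} [NeZero n] {k θ : ℝ} (hk : k ∈ Set.Ioo (0 : ℝ) 1)
    (hθ : 0 < θ) {ψ : (Fin n → ℝ) → ℝ}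
    (hψ : ∀ c : ℝ, 0 < c → ∀ y : Fin n → ℝ, (∀ i, 0 < y i) → ψ (c • y) = c * ψ y)
    (y : Fin n → ℝ) :
    ∫⁻ s in Set.Ioi (0 : ℝ), ENNReal.ofReal (s ^ (n - 1)) *
      (Set.univ.pi fun _ : Fin n => Set.Icc (θ * (1 - k)) (θ * (1 + k))).indicator
        (fun y => ENNReal.ofReal ((θ - psiOpt n k y) ^ 2)) (s • y) ≤
    ∫⁻ s in Set.Ioi (0 : ℝ), ENNReal.ofReal (s ^ (n - 1)) *
      (Set.univ.pi fun _ : Fin n => Set.Icc (θ * (1 - k)) (θ * (1 + k))).indicator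
        (fun y => ENNReal.ofReal ((θ - ψ y) ^ 2)) (s • y) := by
  have ha : 0 < θ * (1 - k) := mul_pos hθ (by linarith [hk.2])
  by_cases hy : ∀ i, 0 < y i
  · rw [lintegral_ray_loss ha hy fun c hc => psiOpt_smul n k hc y,
      lintegral_ray_loss ha hy fun c hc => hψ c hc y hy]
    obtain ⟨i₀, hi₀⟩ := exists_eq_ciInf_of_finite (f := y)
    obtain ⟨i₁, hi₁⟩ := exists_eq_ciSup_of_finite (f := y)
    have hmin : 0 < ⨅ i, y i := hi₀ ▸ hy i₀
    have hmax : 0 < ⨆ i, y i := hi₁ ▸ hy i₁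
    rcases lt_or_ge (θ * (1 - k) / ⨅ i, y i) (θ * (1 + k) / ⨆ i, y i) with hlt | hge
    · have hl := div_pos ha hmin
      rw [setLIntegral_Icc_pow_mul_sq hl hlt.le, setLIntegral_Icc_pow_mul_sq hl hlt.le]
      exact ENNReal.ofReal_le_ofReal (integral_pow_mul_sq_le hl hlt
        (psiOpt_normal_equation (NeZero.ne n) hk hθ hmin hmax hlt) _)
    · rw [setLIntegral_measure_zero _ _ (by simpa [Real.volume_Icc] using hge)]
      exact zero_le
  · push Not at hy
    obtain ⟨i, hi⟩ := hy
    refine setLIntegral_mono' measurableSet_Ioi fun s (hs : 0 < s) => ?_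
    have hnot : s • y ∉ Set.univ.pi fun _ : Fin n => Set.Icc (θ * (1 - k)) (θ * (1 + k)) := by
      intro hmem
      have h1 := (hmem i trivial).1
      have h2 : (s • y) i ≤ 0 := mul_nonpos_of_nonneg_of_nonpos hs.le hi
      linarith
    rw [Set.indicator_of_notMem hnot, Set.indicator_of_notMem hnot]

/-- `ψ* = θ̂_OPT` is scale equivariant and uniformly minimizes the
squared-error risk among scale-equivariant estimators of the scale parameter `θ`
of the scaled uniform model. -/
theorem stmt_17 (n : ℕ) (hn : 2 ≤ n) (k : ℝ) (hk : k ∈ Set.Ioo (0:ℝ) 1) :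
    (∀ c : ℝ, 0 < c → ∀ y : Fin n → ℝ, (∀ i, 0 < y i) →
      psiOpt n k (c • y) = c * psiOpt n k y) ∧
    (∀ ψ : (Fin n → ℝ) → ℝ, Measurable ψ →
      (∀ y : Fin n → ℝ, (∀ i, 0 < y i) → 0 < ψ y) →
      (∀ c : ℝ, 0 < c → ∀ y : Fin n → ℝ, (∀ i, 0 < y i) → ψ (c • y) = c * ψ y) →
      ∀ θ : ℝ, 0 < θ →
        (∫⁻ y : Fin n → ℝ, ENNReal.ofReal ((θ - psiOpt n k y) ^ 2)
            ∂(Measure.pi fun _ : Fin n => unifIcc (θ * (1 - k)) (θ * (1 + k))))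
          ≤ ∫⁻ y : Fin n → ℝ, ENNReal.ofReal ((θ - ψ y) ^ 2)
            ∂(Measure.pi fun _ : Fin n => unifIcc (θ * (1 - k)) (θ * (1 + k)))) := by
  refine ⟨fun c hc y _ => psiOpt_smul n k hc y, fun ψ hψm _ hψ θ hθ => ?_⟩
  have : NeZero n := ⟨by omega⟩
  have ha : 0 < θ * (1 - k) := mul_pos hθ (by linarith [hk.2])
  have hab : θ * (1 - k) < θ * (1 + k) := by nlinarith [hk.1]
  have hbox : MeasurableSet
      (Set.univ.pi fun _ : Fin n => Set.Icc (θ * (1 - k)) (θ * (1 + k))) :=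
    .univ_pi fun _ => measurableSet_Icc
  have hmeas {φ : (Fin n → ℝ) → ℝ} (hφ : Measurable φ) : Measurable
      ((Set.univ.pi fun _ : Fin n => Set.Icc (θ * (1 - k)) (θ * (1 + k))).indicator
        (fun y => ENNReal.ofReal ((θ - φ y) ^ 2))) :=
    ((measurable_const.sub hφ).pow_const 2).ennreal_ofReal.indicator hbox
  have hpos (φ : (Fin n → ℝ) → ℝ) (y : Fin n → ℝ)
      (hy : (Set.univ.pi fun _ : Fin n => Set.Icc (θ * (1 - k)) (θ * (1 + k))).indicator
        (fun y => ENNReal.ofReal ((θ - φ y) ^ 2)) y ≠ 0) : 0 < y 0 :=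
    ha.trans_le (Set.mem_of_indicator_ne_zero hy 0 trivial).1
  rw [pi_unifIcc n _ _ hab, lintegral_smul_measure, lintegral_smul_measure,
    ← lintegral_indicator hbox, ← lintegral_indicator hbox,
    lintegral_eq_lintegral_rays 0 (hmeas (measurable_psiOpt n k)) (hpos _),
    lintegral_eq_lintegral_rays 0 (hmeas hψm) (hpos _)]
  refine mul_le_mul_right (lintegral_mono fun y => ?_) _
  exact mul_le_mul_right (lintegral_ray_loss_psiOpt_le hk hθ hψ y) _
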